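/- Let a(n) = \sum_{k=0}^{n} \binom{n}{k}^2 \binom{n+k}{k}, and let b : \mathbb{N} \to \mathbb{Q} be the unique sequence with b(0) = 0, b(1) = 1 and n^2 b(n) - (11 n^2 - 11 n + 3) b(n-1) - (n-1)^2 b(n-2) = 0 for all n \ge 2. Then the sequence of ratios b(n)/a(n) converges, and \lim_{n \to \infty} b(n)/a(n) = \zeta(2)/5 = \pi^2/30. -/

import Mathlib

open Filter Real

/-- the summand `C(n,k)^2 C(n+k,k)`. -/
noncomputable def apL (n k : ℕ) : ℝ := (n.choose k : ℝ) ^ 2 * ((n + k).choose k : ℝ)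

/-- Apéry's auxiliary double sequence. -/
noncomputable def apC (n k : ℕ) : ℝ :=
  2 * ∑ m ∈ Finset.range n, (-1 : ℝ) ^ m / ((m : ℝ) + 1) ^ 2 +
  ∑ m ∈ Finset.range k, (-1 : ℝ) ^ (n + m) /
    (((m : ℝ) + 1) ^ 2 * (n.choose (m + 1) : ℝ) * ((n + m + 1).choose (m + 1) : ℝ))

/-- certificate. -/
noncomputable def apB (n k : ℕ) : ℝ :=
  ((k : ℝ) ^ 2 + 3 * (2 * n + 1) * k - 11 * (n : ℝ) ^ 2 - 9 * n - 2) * apL n k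

lemma ch_up (n k : ℕ) : ((n + 1).choose k : ℝ) * ((n : ℝ) + 1 - k) = (n + 1) * (n.choose k : ℝ) := by
  rcases le_or_gt k (n + 1) with h | h
  · have := Nat.choose_mul_succ_eq n k
    have h2 : ((n + 1 - k : ℕ) : ℝ) = (n : ℝ) + 1 - k := by rw [Nat.cast_sub h]; push_cast; ring
    rw [← h2]
    have h3 : ((n.choose k * (n + 1) : ℕ) : ℝ) = (((n + 1).choose k * (n + 1 - k) : ℕ) : ℝ) := by
      rw [this]
    push_cast at h3
    linarith
  · rw [Nat.choose_eq_zero_of_lt h, Nat.choose_eq_zero_of_lt (by omega : n < k)]; simp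

lemma ch_diag (n k : ℕ) : ((n + 1).choose (k + 1) : ℝ) * ((k : ℝ) + 1) = (n + 1) * (n.choose k : ℝ) := by
  have := Nat.add_one_mul_choose_eq n k
  have h3 : (((n + 1) * n.choose k : ℕ) : ℝ) = (((n + 1).choose (k + 1) * (k + 1) : ℕ) : ℝ) := by
    rw [this]
  push_cast at h3
  linarith

lemma ch_right (n k : ℕ) : (n.choose (k + 1) : ℝ) * ((k : ℝ) + 1) = (n - k) * (n.choose k : ℝ) := by
  have h1 := ch_diag n k
  have h2 : ((n + 1).choose (k + 1) : ℝ) = n.choose k + n.choose (k + 1) := by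
    exact_mod_cast Nat.choose_succ_succ n k
  rw [h2] at h1
  linarith

lemma ch_up2 (n k : ℕ) : ((n + 1 + k).choose k : ℝ) = (n + 1 + k) / (n + 1) * ((n + k).choose k : ℝ) := by
  have h := ch_up (n + k) k
  have e : n + 1 + k = n + k + 1 := by ring
  rw [e]
  push_cast at h
  have : (n : ℝ) + 1 ≠ 0 := by positivity
  field_simp
  linarith

lemma ch_diag2 (n k : ℕ) : ((n + (k + 1)).choose (k + 1) : ℝ) = (n + 1 + k) / (k + 1) * ((n + k).choose k : ℝ) := by
  have h := ch_diag (n + k) k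
  rw [← add_assoc]
  push_cast at h
  have : (k : ℝ) + 1 ≠ 0 := by positivity
  field_simp
  linarith

lemma ch_pos {n k : ℕ} (h : k ≤ n) : (0 : ℝ) < n.choose k := by
  exact_mod_cast Nat.choose_pos h

lemma apC_succ (n k : ℕ) : apC n (k + 1) = apC n k + (-1 : ℝ) ^ (n + k) /
    (((k : ℝ) + 1) ^ 2 * (n.choose (k + 1) : ℝ) * ((n + k + 1).choose (k + 1) : ℝ)) := by
  unfold apC
  rw [Finset.sum_range_succ _ k]
  ring

lemma apC_diff (n k : ℕ) (h : k ≤ n) : apC (n + 1) k - apC n k =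
    2 * (-1 : ℝ) ^ (n + k) / (((n : ℝ) + 1) ^ 2 * (n.choose k : ℝ) * ((n + 1 + k).choose k : ℝ)) := by
  induction k with
  | zero =>
    unfold apC
    simp [Finset.sum_range_succ]
    ring
  | succ k ih =>
    have ih := ih (by omega)
    rw [apC_succ, apC_succ]
    obtain ⟨j, rfl⟩ : ∃ j, n = k + 1 + j := ⟨n - (k + 1), by omega⟩
    have h1 := ch_right (k + 1 + j) k
    have h2 := ch_diag (k + 1 + j) k
    have p1 := ch_pos (show k ≤ k + 1 + j by omega)
    have p2 := ch_pos (show k ≤ (k + 1 + j) + k by omega)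
    have e1 := ch_up2 (k + 1 + j) k
    have e2 := ch_diag2 (k + 1 + j) k
    have e3 := ch_diag2 (k + 1 + j + 1) k
    rw [e1] at ih e3
    rw [e3]
    rw [show k + 1 + j + k + 1 = k + 1 + j + (k + 1) by ring, e2,
      show k + 1 + j + 1 + k + 1 = k + 1 + j + 1 + (k + 1) by ring, e3]
    have d1 : ((k + 1 + j).choose (k + 1) : ℝ) = (j + 1) / (k + 1) * ((k + 1 + j).choose k : ℝ) := by
      have : (k : ℝ) + 1 ≠ 0 := by positivity
      push_cast at h1
      field_simp
      linarith
    have d2 : ((k + 1 + j + 1).choose (k + 1) : ℝ) = (k + 1 + j + 1) / (k + 1) * ((k + 1 + j).choose k : ℝ) := by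
      have : (k : ℝ) + 1 ≠ 0 := by positivity
      push_cast at h2
      field_simp
      linarith
    rw [d1, d2]
    have s1 : (-1 : ℝ) ^ (k + 1 + j + 1 + k) = -(-1 : ℝ) ^ (k + 1 + j + k) := by
      rw [show k + 1 + j + 1 + k = (k + 1 + j + k) + 1 by ring, pow_succ]; ring
    have s2 : (-1 : ℝ) ^ (k + 1 + j + (k + 1)) = -(-1 : ℝ) ^ (k + 1 + j + k) := by
      rw [← add_assoc, pow_succ]; ring
    rw [s1, s2]
    have ih' := eq_add_of_sub_eq ih
    rw [ih']
    push_cast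
    generalize ((k + 1 + j).choose k : ℝ) = x at *
    generalize ((k + 1 + j + k).choose k : ℝ) = y at *
    generalize (-1 : ℝ) ^ (k + 1 + j + k) = e at *
    field_simp
    ring

lemma L1 (n k : ℕ) : apL n k * (apC (n + 1) k - apC n k) =
    2 * (-1 : ℝ) ^ (n + k) * (n.choose k : ℝ) / (((n : ℝ) + 1) * (n + 1 + k)) := by
  rcases le_or_gt k n with h | h
  · rw [apC_diff n k h, ch_up2]
    have p1 := ch_pos h
    have p2 := ch_pos (show k ≤ n + k by omega)
    unfold apL
    field_simp
  · unfold apL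
    rw [Nat.choose_eq_zero_of_lt h]; simp

lemma L2 (n k : ℕ) (h : k ≤ n) : apL (n + 1) k * (apC (n + 1) k - apC n k) =
    2 * (-1 : ℝ) ^ (n + k) * ((n + 1).choose k : ℝ) / (((n : ℝ) + 1) * (n + 1 - k)) := by
  rw [apC_diff n k h]
  have p1 := ch_pos h
  have p2 := ch_pos (show k ≤ n + 1 + k by omega)
  have h1 := ch_up n k
  have h3 : (0 : ℝ) < (n : ℝ) + 1 - k := by
    have : (k : ℝ) ≤ n := by exact_mod_cast h
    linarith
  have h4 : ((n + 1).choose k : ℝ) = (n + 1) * (n.choose k : ℝ) / ((n : ℝ) + 1 - k) := by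
    field_simp; linarith
  unfold apL
  rw [h4]
  field_simp

lemma L3 (n k : ℕ) (h : k < n) : apL n k * (apC n (k + 1) - apC n k) =
    (-1 : ℝ) ^ (n + k) * (n.choose k : ℝ) / (((n : ℝ) - k) * (n + 1 + k)) := by
  rw [apC_succ]
  have p1 := ch_pos h.le
  have p2 := ch_pos (show k ≤ n + k by omega)
  have h1 := ch_right n k
  have h3 : (0 : ℝ) < (n : ℝ) - k := by
    have : (k : ℝ) < n := by exact_mod_cast h
    linarith
  have h4 : (n.choose (k + 1) : ℝ) = (n - k) * (n.choose k : ℝ) / ((k : ℝ) + 1) := by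
    field_simp; linarith
  unfold apL
  rw [add_assoc n k 1, ch_diag2, h4, add_sub_cancel_left]
  field_simp

/-- all binomials in terms of two base ones -/
lemma cert (N k : ℕ) : ((N : ℝ) + 2) ^ 2 * apL (N + 2) (k + 1)
    - (11 * ((N : ℝ) + 1) ^ 2 + 11 * (N + 1) + 3) * apL (N + 1) (k + 1)
    - ((N : ℝ) + 1) ^ 2 * apL N (k + 1) = apB (N + 1) (k + 1) - apB (N + 1) k := by
  have h1 := ch_diag (N + 1) k
  have h2 := ch_right (N + 1) k
  have h3 := ch_up N (k + 1)
  have g0 := ch_up2 N k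
  have g1 := ch_diag2 N k
  have g2 := ch_diag2 (N + 1) k
  have g3 := ch_diag2 (N + 1 + 1) k
  have g4 := ch_up2 (N + 1) k
  unfold apB apL
  rw [show N + 2 = N + 1 + 1 by ring]
  rw [g4, g0] at g3
  rw [g0] at g2
  rw [g1, g2, g3, g0]
  have d1 : ((N + 1 + 1).choose (k + 1) : ℝ) = (N + 2) / (k + 1) * ((N + 1).choose k : ℝ) := by
    push_cast at h1; field_simp; linarith
  have d2 : ((N + 1).choose (k + 1) : ℝ) = (N + 1 - k) / (k + 1) * ((N + 1).choose k : ℝ) := by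
    push_cast at h2; field_simp; linarith
  have d3 : (N.choose (k + 1) : ℝ) = (N - k) / (N + 1) * ((N + 1 - k) / (k + 1) * ((N + 1).choose k : ℝ)) := by
    rw [d2] at h3
    push_cast at h3; field_simp at h3 ⊢; linarith
  rw [d1, d2, d3]
  push_cast
  field_simp
  ring

/-- summand of the recurrence -/
noncomputable def apT (N k : ℕ) : ℝ := ((N : ℝ) + 2) ^ 2 * (apL (N + 2) k * apC (N + 2) k)
    - (11 * ((N : ℝ) + 1) ^ 2 + 11 * (N + 1) + 3) * (apL (N + 1) k * apC (N + 1) k)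
    - ((N : ℝ) + 1) ^ 2 * (apL N k * apC N k)

lemma tele (N K : ℕ) (h : K ≤ N + 1) : ∑ k ∈ Finset.range (K + 1), apT N k =
    apB (N + 1) K * apC (N + 1) K
      - 3 * (-1 : ℝ) ^ (N + 1 + K) * ((N + 1).choose K : ℝ) * K / (N + 1) := by
  induction K with
  | zero =>
    have h1 := L1 N 0
    have h2 := L2 (N + 1) 0 (by omega)
    simp [apT, apB, apL, pow_succ] at h1 h2 ⊢
    rw [show N + 1 + 1 = N + 2 by ring] at h2
    rw [sub_eq_iff_eq_add] at h1 h2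
    rw [h2, h1]
    generalize (-1 : ℝ) ^ N = e
    have : (N : ℝ) + 1 + 1 ≠ 0 := by positivity
    field_simp
    ring
  | succ k ih =>
    rw [Finset.sum_range_succ, ih (by omega)]
    have h1 := L1 N (k + 1)
    have h2 := L2 (N + 1) (k + 1) h
    have h3 := L3 (N + 1) k (by omega)
    have h4 := cert N k
    rw [show N + 1 + 1 = N + 2 by ring] at h2
    have hB : apB (N + 1) k * apC (N + 1) k = apB (N + 1) k * apC (N + 1) (k + 1)
      - ((k : ℝ) ^ 2 + 3 * (2 * (N + 1) + 1) * k - 11 * ((N : ℝ) + 1) ^ 2 - 9 * (N + 1) - 2) *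
      (apL (N + 1) k * (apC (N + 1) (k + 1) - apC (N + 1) k)) := by
      unfold apB; push_cast; ring
    rw [hB, h3]
    have hT : apT N (k + 1) = (apB (N + 1) (k + 1) - apB (N + 1) k) * apC (N + 1) (k + 1)
       + ((N : ℝ) + 2) ^ 2 * (apL (N + 2) (k + 1) * (apC (N + 2) (k + 1) - apC (N + 1) (k + 1)))
       + ((N : ℝ) + 1) ^ 2 * (apL N (k + 1) * (apC (N + 1) (k + 1) - apC N (k + 1))) := by
      rw [← h4]; unfold apT; ring
    rw [hT, h1, h2]
    have h1 := ch_diag (N + 1) k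
    have h2 := ch_right (N + 1) k
    have h3 := ch_up N (k + 1)
    have d1 : ((N + 2).choose (k + 1) : ℝ) = (N + 2) / (k + 1) * ((N + 1).choose k : ℝ) := by
      push_cast at h1; field_simp; linarith
    have d2 : ((N + 1).choose (k + 1) : ℝ) = (N + 1 - k) / (k + 1) * ((N + 1).choose k : ℝ) := by
      push_cast at h2; field_simp; linarith
    have d3 : (N.choose (k + 1) : ℝ) = (N - k) / (N + 1) * ((N + 1 - k) / (k + 1) * ((N + 1).choose k : ℝ)) := by
      rw [d2] at h3
      push_cast at h3; field_simp at h3 ⊢; linarith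
    rw [d1, d2, d3]
    have q : (0 : ℝ) < (N : ℝ) + 1 - k := by
      have : (k : ℝ) + 1 ≤ N + 1 := by exact_mod_cast h
      linarith
    have q1 : ((N : ℝ) + 1 + 1 - (k + 1)) ≠ 0 := by
      intro h; linarith
    rw [show N + (k + 1) = N + k + 1 by ring, show N + 1 + (k + 1) = N + k + 1 + 1 by ring,
      show N + 1 + k = N + k + 1 by ring]
    simp only [pow_succ]
    push_cast
    generalize (-1 : ℝ) ^ (N + k) = e
    generalize ((N + 1).choose k : ℝ) = x
    rw [show ((N : ℝ) + 1 + 1 - (k + 1)) = N + 1 - k by ring]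
    field_simp
    ring

lemma total (N : ℕ) : ∑ k ∈ Finset.range (N + 3), apT N k = 0 := by
  rw [Finset.sum_range_succ, tele N (N + 1) le_rfl]
  have h1 := apC_diff (N + 1) (N + 1) le_rfl
  have h2 := apC_succ (N + 2) (N + 1)
  rw [show N + 1 + 1 = N + 2 by ring] at h1 h2
  have z1 : apL (N + 1) (N + 2) = 0 := by
    unfold apL; rw [Nat.choose_eq_zero_of_lt (by omega : N + 1 < N + 2)]; simp
  have z2 : apL N (N + 2) = 0 := by
    unfold apL; rw [Nat.choose_eq_zero_of_lt (by omega : N < N + 2)]; simp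
  unfold apT
  rw [z1, z2, h2, eq_add_of_sub_eq h1]
  unfold apB apL
  have g1 := ch_diag2 (N + 2) (N + 1)
  have g0 := ch_up2 (N + 1) (N + 1)
  rw [show N + 1 + 1 = N + 2 by ring] at g1 g0
  rw [show N + 2 + (N + 1) + 1 = N + 2 + (N + 2) by ring, g1, g0]
  simp only [Nat.choose_self]
  have p2 := ch_pos (show N + 1 ≤ N + 1 + (N + 1) by omega)
  have s1 : (-1 : ℝ) ^ (N + 1 + (N + 1)) = 1 := Even.neg_one_pow ⟨_, rfl⟩
  have s2 : (-1 : ℝ) ^ (N + 2 + (N + 1)) = -1 := Odd.neg_one_pow ⟨N + 1, by ring⟩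
  rw [s1, s2]
  push_cast
  generalize ((N + 1 + (N + 1)).choose (N + 1) : ℝ) = y at *
  field_simp
  ring

noncomputable def apS (n : ℕ) : ℝ := ∑ k ∈ Finset.range (n + 1), apL n k * apC n k

lemma apS_rec (N : ℕ) : ((N : ℝ) + 2) ^ 2 * apS (N + 2)
    - (11 * ((N : ℝ) + 1) ^ 2 + 11 * (N + 1) + 3) * apS (N + 1)
    - ((N : ℝ) + 1) ^ 2 * apS N = 0 := by
  have h := total N
  unfold apT at h
  rw [Finset.sum_sub_distrib, Finset.sum_sub_distrib, ← Finset.mul_sum, ← Finset.mul_sum,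
    ← Finset.mul_sum] at h
  have z1 : apL (N + 1) (N + 2) = 0 := by
    unfold apL; rw [Nat.choose_eq_zero_of_lt (by omega : N + 1 < N + 2)]; simp
  have z2 : apL N (N + 2) = 0 := by
    unfold apL; rw [Nat.choose_eq_zero_of_lt (by omega : N < N + 2)]; simp
  have z3 : apL N (N + 1) = 0 := by
    unfold apL; rw [Nat.choose_eq_zero_of_lt (by omega : N < N + 1)]; simp
  have e1 : ∑ k ∈ Finset.range (N + 3), apL (N + 1) k * apC (N + 1) k = apS (N + 1) := by
    unfold apS; rw [Finset.sum_range_succ, z1]; simp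
  have e2 : ∑ k ∈ Finset.range (N + 3), apL N k * apC N k = apS N := by
    unfold apS; rw [Finset.sum_range_succ, Finset.sum_range_succ, z2, z3]; simp
  rw [e1, e2] at h
  exact h

lemma apS_zero : apS 0 = 0 := by simp [apS, apC]

lemma apS_one : apS 1 = 5 := by
  simp [apS, apC, apL, Finset.sum_range_succ]; norm_num

lemma apC_bound (n k : ℕ) (h : k ≤ n) :
    |apC n k - 2 * ∑ m ∈ Finset.range n, (-1 : ℝ) ^ m / ((m : ℝ) + 1) ^ 2| ≤
      (∑' m : ℕ, 1 / ((m : ℝ) + 1) ^ 2) / ((n : ℝ) + 1) := by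
  have hs : Summable (fun m : ℕ => 1 / ((m : ℝ) + 1) ^ 2) := by
    have := (summable_nat_add_iff 1).2 (Real.summable_one_div_nat_pow.2 (by norm_num : 1 < 2))
    simpa using this
  unfold apC
  rw [add_sub_cancel_left]
  refine (Finset.abs_sum_le_sum_abs _ _).trans ?_
  have : ∑ m ∈ Finset.range k, 1 / ((m : ℝ) + 1) ^ 2 / ((n : ℝ) + 1) ≤
      (∑' m : ℕ, 1 / ((m : ℝ) + 1) ^ 2) / ((n : ℝ) + 1) := by
    rw [← Finset.sum_div]
    gcongr
    exact hs.sum_le_tsum _ (fun i _ => by positivity)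
  refine le_trans (Finset.sum_le_sum fun m hm => ?_) this
  have hm := Finset.mem_range.1 hm
  rw [abs_div, abs_pow, abs_neg, abs_one, one_pow, div_div]
  have c1 : (1 : ℝ) ≤ n.choose (m + 1) := by
    exact_mod_cast Nat.choose_pos (by omega : m + 1 ≤ n)
  have c2 : (n : ℝ) + 1 ≤ (n + m + 1).choose (m + 1) := by
    have : n + 1 ≤ (n + m + 1).choose (m + 1) := by
      have h1 : (n + 1).choose 1 ≤ (n + m + 1).choose (m + 1) := by
        rw [← Nat.choose_symm (by omega : 1 ≤ n + 1),
          ← Nat.choose_symm (by omega : m + 1 ≤ n + m + 1)]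
        rw [show n + 1 - 1 = n by omega, show n + m + 1 - (m + 1) = n by omega]
        exact Nat.choose_le_choose n (by omega)
      simpa using h1
    exact_mod_cast this
  rw [abs_of_nonneg (by positivity)]
  apply one_div_le_one_div_of_le (by positivity)
  apply mul_le_mul _ c2 (by positivity) (by positivity)
  exact le_mul_of_one_le_right (by positivity) c1

lemma zeta_sum : HasSum (fun m : ℕ => 1 / ((m : ℝ) + 1) ^ 2) (π ^ 2 / 6) := by
  have h := (hasSum_nat_add_iff' 1).2 hasSum_zeta_two
  simpa using h

lemma hs_congr {f g : ℕ → ℝ} {x : ℝ} (h : HasSum f x) (e : ∀ k, g k = f k) : HasSum g x := by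
  rwa [funext e]

lemma alt_sum : Tendsto (fun n : ℕ => 2 * ∑ m ∈ Finset.range n, (-1 : ℝ) ^ m / ((m : ℝ) + 1) ^ 2)
    atTop (nhds (π ^ 2 / 6)) := by
  have hz := zeta_sum
  have ho : HasSum (fun k : ℕ => 1 / (((2 * k + 1 : ℕ) : ℝ) + 1) ^ 2) (π ^ 2 / 6 / 4) := by
    refine hs_congr (hz.div_const 4) ?_
    intro k
    push_cast
    field_simp
    ring
  have hes : Summable (fun k : ℕ => 1 / (((2 * k : ℕ) : ℝ) + 1) ^ 2) :=
    hz.summable.comp_injective (i := fun k : ℕ => 2 * k) (fun a b h => by simpa using h)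
  have he := hes.hasSum
  have hall := HasSum.even_add_odd (f := fun m : ℕ => 1 / ((m : ℝ) + 1) ^ 2) he ho
  have hu := hz.unique hall
  have halt : HasSum (fun m : ℕ => (-1 : ℝ) ^ m / ((m : ℝ) + 1) ^ 2)
      ((∑' k : ℕ, 1 / (((2 * k : ℕ) : ℝ) + 1) ^ 2) + -(π ^ 2 / 6 / 4)) := by
    apply HasSum.even_add_odd
    · refine hs_congr he ?_
      intro k
      simp
    · refine hs_congr ho.neg ?_
      intro k
      rw [pow_succ, pow_mul]; simp [neg_div]
  have := (halt.mul_left 2).tendsto_sum_nat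
  simp only [← Finset.mul_sum] at this
  convert this using 2
  linarith

/-- Apéry's theorem for ζ(2): with `a n = ∑_k (n choose k)² ((n+k) choose k)` and `b` the
solution of the same recursion with initial values `b 0 = 0`, `b 1 = 1`, the ratios
`b n / a n` converge to `ζ(2)/5 = π²/30`. -/
theorem apery_limit_zeta2
    (a b : ℕ → ℚ)
    (ha : ∀ n : ℕ, a n = ∑ k ∈ Finset.range (n + 1),
      ((n.choose k : ℚ)) ^ 2 * (((n + k).choose k : ℚ)))
    (hb0 : b 0 = 0) (hb1 : b 1 = 1)
    (hb : ∀ n : ℕ, 2 ≤ n →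
      (n : ℚ) ^ 2 * b n
        - (11 * (n : ℚ) ^ 2 - 11 * (n : ℚ) + 3) * b (n - 1)
        - ((n : ℚ) - 1) ^ 2 * b (n - 2) = 0) :
    Tendsto (fun n : ℕ => ((b n : ℝ) / (a n : ℝ))) atTop
        (nhds ((∑' m : ℕ, 1 / ((m : ℝ) + 1) ^ 2) / 5)) ∧
      (∑' m : ℕ, 1 / ((m : ℝ) + 1) ^ 2) / 5 = π ^ 2 / 30 := by
  have hZ : (∑' m : ℕ, 1 / ((m : ℝ) + 1) ^ 2) = π ^ 2 / 6 := zeta_sum.tsum_eq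
  refine ⟨?_, by rw [hZ]; ring⟩
  have hbS : ∀ n : ℕ, 5 * (b n : ℝ) = apS n ∧ 5 * (b (n + 1) : ℝ) = apS (n + 1) := by
    intro n
    induction n with
    | zero => rw [hb0, hb1, apS_zero, apS_one]; norm_num
    | succ n ih =>
      refine ⟨ih.2, ?_⟩
      have h1 := congrArg (Rat.cast : ℚ → ℝ) (hb (n + 2) (by omega))
      rw [show n + 2 - 1 = n + 1 by omega, show n + 2 - 2 = n by omega] at h1
      push_cast at h1
      have h2 := apS_rec n
      rw [← ih.1, ← ih.2] at h2
      have p : ((n : ℝ) + 2) ^ 2 ≠ 0 := by positivity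
      apply mul_left_cancel₀ p
      linear_combination 5 * h1 - h2
  have haL : ∀ n : ℕ, (a n : ℝ) = ∑ k ∈ Finset.range (n + 1), apL n k := by
    intro n
    rw [ha n]
    push_cast
    rfl
  have hLnn : ∀ n k : ℕ, 0 ≤ apL n k := fun n k => by unfold apL; positivity
  have hapos : ∀ n : ℕ, 0 < (a n : ℝ) := by
    intro n
    rw [haL]
    apply Finset.sum_pos' (fun k _ => hLnn n k)
    exact ⟨0, by simp, by simp [apL]⟩
  have key : ∀ n : ℕ, |5 * ((b n : ℝ) / a n)
      - 2 * ∑ m ∈ Finset.range n, (-1 : ℝ) ^ m / ((m : ℝ) + 1) ^ 2| ≤ (π ^ 2 / 6) / (n + 1) := by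
    intro n
    set s := 2 * ∑ m ∈ Finset.range n, (-1 : ℝ) ^ m / ((m : ℝ) + 1) ^ 2 with hs
    have hp := hapos n
    have e : 5 * ((b n : ℝ) / a n) - s = (∑ k ∈ Finset.range (n + 1), apL n k * (apC n k - s)) / a n := by
      simp only [mul_sub, Finset.sum_sub_distrib, ← Finset.sum_mul]
      rw [← haL]
      have := (hbS n).1
      unfold apS at this
      rw [← this]
      field_simp
    rw [e, abs_div, abs_of_pos hp, div_le_iff₀ hp]
    refine (Finset.abs_sum_le_sum_abs _ _).trans ?_
    rw [haL, Finset.mul_sum]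
    apply Finset.sum_le_sum
    intro k hk
    rw [abs_mul, abs_of_nonneg (hLnn n k), mul_comm]
    apply mul_le_mul_of_nonneg_right _ (hLnn n k)
    have := apC_bound n k (by have := Finset.mem_range.1 hk; omega)
    rwa [hZ] at this
  have h0 : Tendsto (fun n : ℕ => (π ^ 2 / 6) / ((n : ℝ) + 1)) atTop (nhds 0) := by
    have := (tendsto_one_div_add_atTop_nhds_zero_nat (𝕜 := ℝ)).const_mul (π ^ 2 / 6)
    simpa [div_eq_mul_inv] using this
  have h1 := squeeze_zero_norm (fun n => by rw [Real.norm_eq_abs]; exact key n) h0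
  have h2 := (h1.add alt_sum).div_const 5
  rw [hZ]
  convert h2 using 2 with n
  · ring
  · ring
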